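/- arXiv:2207.08788 — 6 statements merged into one kernel-verified Lean document; each statement's English description precedes it below -/
import Mathlib

section
/- Suppose that the finite group G acts transitively, faithfully and with fixity 4 on a finite set Ω, let α ∈ Ω, and let p ≥ 5 be a prime dividing |G_α|. Then G_α contains a Sylow p-subgroup of G, that is, there is a Sylow p-subgroup P of G with P ≤ G_α. -/
/-- A `p`-subgroup centralizing an element with fewer than `p` fixed points fixes every fixed
point of that element. -/
theorem IsPGroup.le_stabilizer_of_commute {G : Type*} [Group G] {Ω : Type*} [Finite Ω]
    [MulAction G Ω] {p : ℕ} [Fact p.Prime] {Q : Subgroup G} (hQ : IsPGroup p Q) {z : G}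
    (hcomm : ∀ q ∈ Q, Commute q z) (hz : Set.ncard {ω : Ω | z • ω = ω} < p)
    {α : Ω} (hα : z • α = α) : Q ≤ MulAction.stabilizer G α := by
  have hsub : MulAction.orbit Q α ⊆ {ω : Ω | z • ω = ω} := by
    rintro _ ⟨⟨q, hq⟩, rfl⟩
    change z • q • α = q • α
    rw [← mul_smul, ← (hcomm q hq).eq, mul_smul, hα]
  have hle : (MulAction.orbit Q α).ncard < p := (Set.ncard_le_ncard hsub).trans_lt hz
  obtain ⟨k, hk⟩ := hQ.card_orbit α
  rw [Nat.card_coe_set_eq] at hk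
  rw [hk] at hle
  have hk0 : k = 0 := by
    by_contra h
    exact absurd hle (not_lt.mpr (Nat.le_self_pow h p))
  rw [hk0, pow_zero, Set.ncard_eq_one] at hk
  obtain ⟨β, hβ⟩ := hk
  have hαβ : α = β := by
    have := MulAction.mem_orbit_self (M := Q) α
    rwa [hβ] at this
  intro q hq
  have hmem : (⟨q, hq⟩ : Q) • α ∈ MulAction.orbit Q α := MulAction.mem_orbit _ _
  rw [hβ] at hmem
  exact MulAction.mem_stabilizer_iff.mpr ((show q • α = β from hmem).trans hαβ.symm)


/-- If the finite group `G` acts transitively, faithfully and with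
fixity 4 on a finite set `Ω`, `α ∈ Ω`, and `p ≥ 5` is a prime dividing `|G_α|`, then
`G_α` contains a Sylow `p`-subgroup of `G`. -/
theorem stmt_2 {G : Type*} [Group G] [Finite G] {Ω : Type*} [Finite Ω] [MulAction G Ω]
    [MulAction.IsPretransitive G Ω] [FaithfulSMul G Ω]
    (hfix : ∀ g : G, g ≠ 1 → Set.ncard {ω : Ω | g • ω = ω} ≤ 4)
    (hfix4 : ∃ g : G, g ≠ 1 ∧ Set.ncard {ω : Ω | g • ω = ω} = 4)
    (α : Ω) (p : ℕ) (hp : p.Prime) (hp5 : 5 ≤ p)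
    (hdvd : p ∣ Nat.card ↥(MulAction.stabilizer G α)) :
    ∃ P : Sylow p G, (P : Subgroup G) ≤ MulAction.stabilizer G α := by
  have : Fact p.Prime := ⟨hp⟩
  have hlt : ∀ g : G, g ≠ 1 → Set.ncard {ω : Ω | g • ω = ω} < p := fun g hg =>
    (hfix g hg).trans_lt (by omega)
  obtain ⟨⟨x, hxα⟩, hx⟩ := exists_prime_orderOf_dvd_card' p hdvd
  rw [Subgroup.orderOf_mk] at hx
  have hx1 : x ≠ 1 := by
    rintro rfl
    rw [orderOf_one] at hx
    exact hp.ne_one hx.symm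
  have hxp : IsPGroup p (Subgroup.zpowers x) :=
    IsPGroup.of_card (n := 1) (by rw [Nat.card_zpowers, hx, pow_one])
  obtain ⟨P, hP⟩ := hxp.exists_le_sylow
  have hxP : x ∈ P := hP (Subgroup.mem_zpowers x)
  have : Nontrivial P := ⟨⟨⟨x, hxP⟩, 1, fun h => hx1 (congrArg Subtype.val h)⟩⟩
  have := P.isPGroup'.center_nontrivial
  obtain ⟨⟨⟨z, hzP⟩, hz⟩, hz1⟩ := exists_ne (1 : Subgroup.center P)
  have hz1 : z ≠ 1 := by
    rintro rfl
    exact hz1 rfl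
  have hzcomm : ∀ q ∈ P, Commute q z := fun q hq =>
    congrArg Subtype.val (Subgroup.mem_center_iff.mp hz ⟨q, hq⟩)
  have hzpow : Subgroup.zpowers z ≤ P := (Subgroup.zpowers_le).mpr hzP
  have hzα : z • α = α := by
    refine IsPGroup.le_stabilizer_of_commute (P.isPGroup'.to_le hzpow) (z := x) ?_ (hlt x hx1)
      hxα (Subgroup.mem_zpowers z)
    rintro _ ⟨n, rfl⟩
    exact (hzcomm x hxP).symm.zpow_left n
  exact ⟨P, IsPGroup.le_stabilizer_of_commute P.isPGroup' hzcomm (hlt z hz1) hzα⟩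
end

section
/- Suppose that the finite group G acts transitively, faithfully and with fixity 4 on a finite set Ω, and let H be a nontrivial four point stabilizer. Then H is a TI-subgroup of G: for every g ∈ G, either gHg⁻¹ = H or gHg⁻¹ ∩ H is the trivial subgroup. -/
/-- Let the finite group `G` act transitively, faithfully and with
fixity 4 on a finite set `Ω`, and let `H` be a nontrivial four point stabilizer.
Then `H` is a TI-subgroup of `G`: for every `g ∈ G`, either `gHg⁻¹ = H` or
`gHg⁻¹ ∩ H = 1`. -/
theorem stmt_5 {G : Type*} [Group G] [Finite G] {Ω : Type*} [Finite Ω] [MulAction G Ω]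
    [MulAction.IsPretransitive G Ω] [FaithfulSMul G Ω]
    (hfix : ∀ g : G, g ≠ 1 → Set.ncard {ω : Ω | g • ω = ω} ≤ 4)
    (hfix4 : ∃ g : G, g ≠ 1 ∧ Set.ncard {ω : Ω | g • ω = ω} = 4)
    (Δ : Finset Ω) (hΔcard : Δ.card = 4)
    (H : Subgroup G) (hHne : H ≠ ⊥)
    (hH : ∀ g : G, g ∈ H ↔ ∀ ω ∈ Δ, g • ω = ω) :
    ∀ g : G, H.map (MulAut.conj g).toMonoidHom = H
      ∨ H.map (MulAut.conj g).toMonoidHom ⊓ H = ⊥ := by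
  have fixed_iff : ∀ x ∈ H, x ≠ 1 → ∀ ω : Ω, x • ω = ω ↔ ω ∈ Δ := by
    intro x hx hx1 ω
    have hsub : (↑Δ : Set Ω) ⊆ {ω : Ω | x • ω = ω} := fun ω hω => (hH x).1 hx ω hω
    have heq := Set.eq_of_subset_of_ncard_le hsub
      (by rw [Set.ncard_coe_finset, hΔcard]; exact hfix x hx1) (Set.toFinite _)
    exact (Set.ext_iff.1 heq ω).symm
  have mem_conj : ∀ g y : G, y ∈ H.map (MulAut.conj g).toMonoidHom ↔ g⁻¹ * y * g ∈ H := by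
    intro g y
    constructor
    · rintro ⟨h, hh, rfl⟩
      simpa [mul_assoc] using hh
    · intro h
      exact ⟨_, h, by simp [mul_assoc]⟩
  have conj_smul : ∀ (g y : G) (ω : Ω), (g⁻¹ * y * g) • ω = ω ↔ y • g • ω = g • ω := by
    intro g y ω
    rw [mul_smul, mul_smul, inv_smul_eq_iff]
  intro g
  by_cases htriv : H.map (MulAut.conj g).toMonoidHom ⊓ H = ⊥
  · exact Or.inr htriv
  obtain ⟨x, ⟨hxg, hxH⟩, hx1⟩ := (Subgroup.bot_or_exists_ne_one _).resolve_left htriv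
  have hconj1 : g⁻¹ * x * g ≠ 1 := by
    intro h
    apply hx1
    simpa [mul_assoc, inv_mul_eq_iff_eq_mul] using h
  have hΔ : ∀ ω : Ω, g • ω ∈ Δ ↔ ω ∈ Δ := fun ω => by
    rw [← fixed_iff x hxH hx1, ← conj_smul,
      fixed_iff _ ((mem_conj g x).1 hxg) hconj1]
  left
  ext y
  rw [mem_conj, hH, hH]
  simp only [conj_smul]
  constructor
  · intro h ω hω
    have hmem : g⁻¹ • ω ∈ Δ := (hΔ _).1 (by rwa [smul_inv_smul])
    simpa using h _ hmem
  · intro h ω hω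
    exact h _ ((hΔ ω).2 hω)
end

section
/- Suppose that the finite group G acts transitively, faithfully and with fixity 4 on a finite set Ω, let P be a Sylow 3-subgroup of G, let Δ denote the union of the P-orbits on Ω of length at most 3, and assume that 1 ≤ |Δ| ≤ 4 and that P acts freely on Ω ∖ Δ. Let D be the pointwise stabilizer and K the setwise stabilizer of Δ in G. Then: (a) for every g ∈ G with g ∉ K, the order of D ∩ gDg⁻¹ is not divisible by 3; and (b) if |Δ| = 3, then every 3-element of K ∖ D fixes no point of Ω, while every nontrivial 3-element of D fixes exactly three points of Ω. -/
open Pointwise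

/-- An element of `p`-power order of a subgroup `H` containing a Sylow `p`-subgroup `P` is
conjugate in `H` to an element of `P`. -/
theorem Sylow.exists_conj_mem_of_le {G : Type*} [Group G] [Finite G] {p : ℕ} [Fact p.Prime]
    (P : Sylow p G) {H : Subgroup G} (hPH : (P : Subgroup G) ≤ H) {x : G} (hx : x ∈ H)
    (hxp : ∃ m : ℕ, orderOf x = p ^ m) :
    ∃ h ∈ H, h⁻¹ * x * h ∈ (P : Subgroup G) := by
  obtain ⟨m, hm⟩ := hxp
  have hpg : IsPGroup p (Subgroup.zpowers (⟨x, hx⟩ : H)) := by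
    apply IsPGroup.of_card (n := m)
    rw [Nat.card_zpowers, ← hm, Subgroup.orderOf_mk]
  obtain ⟨Q, hQ⟩ := hpg.exists_le_sylow
  obtain ⟨h, rfl⟩ := MulAction.exists_smul_eq H (P.subtype hPH) Q
  have hmem := hQ (Subgroup.mem_zpowers _)
  rw [Sylow.coe_subgroup_smul, Subgroup.mem_pointwise_smul_iff_inv_smul_mem] at hmem
  refine ⟨h, h.2, ?_⟩
  simpa [Subgroup.mem_subgroupOf, ← map_inv, MulAut.conj_apply] using hmem

/-- If `P` acts freely outside `Δ`, then the fixed points of a nontrivial element conjugate into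
`P` by `h` lie in `h • Δ`. -/
theorem mem_smul_set_of_conj_mem_of_fixed {G Ω : Type*} [Group G] [MulAction G Ω]
    {P : Subgroup G} {Δ : Set Ω} (hfree : ∀ ω : Ω, ω ∉ Δ → ∀ g ∈ P, g • ω = ω → g = 1)
    {x h : G} (hx : x ≠ 1) (hh : h⁻¹ * x * h ∈ P) {ω : Ω} (hω : x • ω = ω) :
    ω ∈ h • Δ := by
  rw [Set.mem_smul_set_iff_inv_smul_mem]
  by_contra hnot
  have h1 := hfree _ hnot _ hh (by simp [mul_smul, hω])
  apply hx
  have : x = h * (h⁻¹ * x * h) * h⁻¹ := by group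
  rw [this, h1]
  group

/-- If the Sylow `p`-subgroup `P` acts freely outside the finite set `Δ`, then a nontrivial
`p`-element that fixes a translate of `Δ` pointwise has that translate as its fixed-point set. -/
theorem Sylow.fixed_eq_smul_set_of_free_compl {G Ω : Type*} [Group G] [Finite G] [Finite Ω]
    [MulAction G Ω] {p : ℕ} [Fact p.Prime] (P : Sylow p G) {Δ : Set Ω}
    (hfree : ∀ ω : Ω, ω ∉ Δ → ∀ g ∈ (P : Subgroup G), g • ω = ω → g = 1)
    {x : G} (hx : x ≠ 1) (hxp : ∃ m : ℕ, orderOf x = p ^ m) (g : G)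
    (hfixed : ∀ ω ∈ g • Δ, x • ω = ω) :
    {ω : Ω | x • ω = ω} = g • Δ := by
  obtain ⟨h, -, hh⟩ := P.exists_conj_mem_of_le le_top (Subgroup.mem_top x) hxp
  have hsub : {ω : Ω | x • ω = ω} ⊆ h • Δ := fun ω hω =>
    mem_smul_set_of_conj_mem_of_fixed hfree hx hh hω
  have heq : g • Δ = h • Δ := Set.eq_of_subset_of_ncard_le
    (fun ω hω => hsub (hfixed ω hω)) (by simp [Set.ncard_smul_set]) (Set.toFinite _)
  exact Set.Subset.antisymm (heq ▸ hsub) hfixed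

/-- An element of odd order stabilizing a set of three points and fixing one of them fixes
all of them. -/
theorem fixed_of_ncard_eq_three_of_odd_orderOf {G Ω : Type*} [Group G] [MulAction G Ω]
    {Δ : Set Ω} (hΔ : Δ.ncard = 3) {g : G} (hg : g ∈ MulAction.stabilizer G Δ)
    (hodd : Odd (orderOf g)) {ω : Ω} (hωΔ : ω ∈ Δ) (hω : g • ω = ω) :
    ∀ a ∈ Δ, g • a = a := by
  intro a ha
  have hmaps : ∀ b ∈ Δ, g • b ∈ Δ := fun b hb => by
    rw [MulAction.mem_stabilizer_iff] at hg
    exact hg ▸ Set.smul_mem_smul_set hb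
  by_contra hne
  have haω : a ≠ ω := fun h => hne (h ▸ hω)
  have hgaω : g • a ≠ ω := fun h => haω (MulAction.injective g (h.trans hω.symm))
  have hggaω : g • g • a ≠ ω := fun h => hgaω (MulAction.injective g (h.trans hω.symm))
  have hgga : g • g • a ≠ g • a := fun h => hne (MulAction.injective g h)
  have hsq : g • g • a = a := by
    obtain ⟨x, y, z, -, -, -, rfl⟩ := Set.ncard_eq_three.mp hΔ
    have h1 := hmaps a ha
    have h2 := hmaps _ h1
    simp only [Set.mem_insert_iff, Set.mem_singleton_iff] at ha h1 h2 hωΔ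
    grind
  obtain ⟨k, hk⟩ := hodd
  have hpow : g ^ (2 * k) • a = a := by
    have h2 : g ^ 2 ∈ MulAction.stabilizer G a := by
      rw [MulAction.mem_stabilizer_iff, pow_two, mul_smul, hsq]
    rw [pow_mul]
    exact pow_mem h2 k
  apply hne
  calc g • a = g • g ^ (2 * k) • a := by rw [hpow]
    _ = g ^ orderOf g • a := by rw [hk, pow_succ', mul_smul]
    _ = a := by rw [pow_orderOf_eq_one, one_smul]

/-- Let the finite group `G` act transitively, faithfully and with
fixity 4 on a finite set `Ω`, let `P` be a Sylow 3-subgroup of `G`, let `Δ` be the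
union of the `P`-orbits of length at most 3, and assume `1 ≤ |Δ| ≤ 4` and that `P`
acts freely on `Ω ∖ Δ`.  Let `D` be the pointwise and `K` the setwise stabilizer of
`Δ` in `G`.  Then (a) for `g ∉ K` the order of `D ∩ gDg⁻¹` is not divisible by 3, and
(b) if `|Δ| = 3`, then every 3-element of `K ∖ D` fixes no point of `Ω` while every
nontrivial 3-element of `D` fixes exactly three points of `Ω`. -/
theorem stmt_7 {G : Type*} [Group G] [Finite G] {Ω : Type*} [Finite Ω] [MulAction G Ω]
    [MulAction.IsPretransitive G Ω] [FaithfulSMul G Ω]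
    (hfix : ∀ g : G, g ≠ 1 → Set.ncard {ω : Ω | g • ω = ω} ≤ 4)
    (hfix4 : ∃ g : G, g ≠ 1 ∧ Set.ncard {ω : Ω | g • ω = ω} = 4)
    (P : Sylow 3 G)
    (Δ : Set Ω)
    (hΔ : Δ = {ω : Ω | Set.ncard (MulAction.orbit ↥(P : Subgroup G) ω) ≤ 3})
    (hΔ1 : 1 ≤ Δ.ncard) (hΔ4 : Δ.ncard ≤ 4)
    (hfree : ∀ ω : Ω, ω ∉ Δ → ∀ g ∈ (P : Subgroup G), g • ω = ω → g = 1)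
    (D : Subgroup G) (hD : ∀ g : G, g ∈ D ↔ ∀ ω ∈ Δ, g • ω = ω)
    (K : Subgroup G) (hK : K = MulAction.stabilizer G Δ) :
    (∀ g : G, g ∉ K → ¬ 3 ∣ Nat.card ↥(D ⊓ D.map (MulAut.conj g).toMonoidHom))
      ∧ (Δ.ncard = 3 →
          (∀ g ∈ K, g ∉ D → (∃ m : ℕ, orderOf g = 3 ^ m) →
            {ω : Ω | g • ω = ω} = ∅)
          ∧ (∀ g ∈ D, g ≠ 1 → (∃ m : ℕ, orderOf g = 3 ^ m) →
            Set.ncard {ω : Ω | g • ω = ω} = 3)) := by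
  have hPK : (P : Subgroup G) ≤ K := by
    intro p hp
    rw [hK, MulAction.mem_stabilizer_set]
    intro ω
    have horb : MulAction.orbit (P : Subgroup G) (p • ω) = MulAction.orbit (P : Subgroup G) ω :=
      MulAction.orbit_eq_iff.mpr ⟨⟨p, hp⟩, rfl⟩
    rw [hΔ, Set.mem_ofPred_eq, Set.mem_ofPred_eq, horb]
  refine ⟨?_, fun h3 => ⟨?_, ?_⟩⟩
  · intro g hg hdvd
    obtain ⟨⟨x, hxmem⟩, hx⟩ := exists_prime_orderOf_dvd_card' 3 hdvd
    rw [Subgroup.orderOf_mk] at hx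
    obtain ⟨hxD, hxg⟩ := Subgroup.mem_inf.mp hxmem
    have hx1 : x ≠ 1 := by
      rintro rfl
      simp at hx
    have hfg : ∀ ω ∈ g • Δ, x • ω = ω := by
      obtain ⟨d, hd, rfl⟩ := hxg
      rintro _ ⟨ω, hω, rfl⟩
      simp [mul_smul, (hD d).mp hd ω hω]
    have hf1 : ∀ ω ∈ (1 : G) • Δ, x • ω = ω := by
      simpa only [one_smul] using (hD x).mp hxD
    have hxp : ∃ m : ℕ, orderOf x = 3 ^ m := ⟨1, by simpa using hx⟩
    apply hg
    rw [hK, MulAction.mem_stabilizer_iff, ← P.fixed_eq_smul_set_of_free_compl hfree hx1 hxp g hfg,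
      P.fixed_eq_smul_set_of_free_compl hfree hx1 hxp 1 hf1, one_smul]
  · intro g hg hgD h3g
    rw [Set.eq_empty_iff_forall_notMem]
    intro ω hω
    obtain ⟨k, hk, hkP⟩ := P.exists_conj_mem_of_le hPK hg h3g
    have hg1 : g ≠ 1 := fun h => hgD (h ▸ one_mem D)
    have hωΔ := mem_smul_set_of_conj_mem_of_fixed hfree hg1 hkP hω
    rw [hK, MulAction.mem_stabilizer_iff] at hk
    rw [hk] at hωΔ
    have hodd : Odd (orderOf g) := by
      obtain ⟨m, hm⟩ := h3g
      rw [hm]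
      exact Odd.pow (by decide)
    exact hgD ((hD g).mpr (fixed_of_ncard_eq_three_of_odd_orderOf h3 (hK ▸ hg) hodd hωΔ hω))
  · intro g hg hg1 h3g
    rw [P.fixed_eq_smul_set_of_free_compl hfree hg1 h3g 1
      (by simpa only [one_smul] using (hD g).mp hg), one_smul, h3]
end

section
/- Suppose that the finite group G acts transitively, faithfully and with fixity 4 on a finite set Ω, let P be a Sylow 3-subgroup of G, let Δ denote the union of the P-orbits on Ω of length at most 3, and assume that 1 ≤ |Δ| ≤ 4 and that P acts freely on Ω ∖ Δ. Let K be the setwise stabilizer of Δ in G. Then for every g ∈ G with g ∉ K, the order of K ∩ gKg⁻¹ is not divisible by 9 (its 3-part is at most 3). -/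
open Pointwise

/-- A group larger than an invariant set has a nontrivial element fixing a given point of
that set. -/
theorem exists_smul_eq_self_of_ncard_le {G Ω : Type*} [Group G] [MulAction G Ω]
    [Finite Ω] (Q : Subgroup G) (S : Set Ω) (hS : ∀ q ∈ Q, ∀ x ∈ S, q • x ∈ S)
    (hcard : S.ncard < Nat.card Q) {ω : Ω} (hω : ω ∈ S) :
    ∃ q ∈ Q, q ≠ 1 ∧ q • ω = ω := by
  by_contra! h
  refine hcard.not_ge ?_
  rw [← Nat.card_coe_set_eq]
  refine Nat.card_le_card_of_injective
    (fun q : Q => (⟨(q : G) • ω, hS q q.2 ω hω⟩ : S)) fun a b hab => ?_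
  have hab' : (a : G) • ω = (b : G) • ω := congrArg Subtype.val hab
  by_contra hne
  refine h ((b : G)⁻¹ * a) (Q.mul_mem (Q.inv_mem b.2) a.2) (fun h1 => hne ?_) ?_
  · exact Subtype.ext (inv_mul_eq_one.mp h1).symm
  · rw [mul_smul, hab', inv_smul_smul]

/-- A `p`-subgroup of a group `K` containing the Sylow `p`-subgroup `P` is conjugate inside `K`
to a subgroup of `P`. -/
theorem Sylow.exists_conj_mem_of_le_s8 {G : Type*} [Group G] [Finite G] {p : ℕ} [Fact p.Prime]
    (P : Sylow p G) {K Q : Subgroup G} (hPK : (P : Subgroup G) ≤ K) (hQK : Q ≤ K)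
    (hQ : IsPGroup p Q) : ∃ k ∈ K, ∀ q ∈ Q, k⁻¹ * q * k ∈ P := by
  have hQ' : IsPGroup p (Q.subgroupOf K) :=
    hQ.of_equiv (Subgroup.subgroupOfEquivOfLe hQK).symm
  obtain ⟨R, hR⟩ := hQ'.exists_le_sylow
  obtain ⟨k, hk⟩ := MulAction.exists_smul_eq K R (P.subtype hPK)
  refine ⟨(k : G)⁻¹, K.inv_mem k.2, fun q hq => ?_⟩
  have hqR : (⟨q, hQK hq⟩ : K) ∈ (R : Subgroup K) :=
    hR (by simpa [Subgroup.mem_subgroupOf] using hq)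
  have h : k * ⟨q, hQK hq⟩ * k⁻¹ ∈ (P.subtype hPK : Subgroup K) := by
    rw [← hk, Sylow.coe_subgroup_smul]
    exact Subgroup.smul_mem_pointwise_smul _ (MulAut.conj k) _ hqR
  change _ ∈ (P : Subgroup G)
  simpa [Subgroup.mem_subgroupOf] using h

/-- With `G`, `Ω`, `P`, `Δ`, `K` as in the fixity-4 situation where
`1 ≤ |Δ| ≤ 4` and `P` acts freely on `Ω ∖ Δ`: for every `g ∉ K`, the order of
`K ∩ gKg⁻¹` is not divisible by 9. -/
theorem stmt_8 {G : Type*} [Group G] [Finite G] {Ω : Type*} [Finite Ω] [MulAction G Ω]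
    [MulAction.IsPretransitive G Ω] [FaithfulSMul G Ω]
    (hfix : ∀ g : G, g ≠ 1 → Set.ncard {ω : Ω | g • ω = ω} ≤ 4)
    (hfix4 : ∃ g : G, g ≠ 1 ∧ Set.ncard {ω : Ω | g • ω = ω} = 4)
    (P : Sylow 3 G)
    (Δ : Set Ω)
    (hΔ : Δ = {ω : Ω | Set.ncard (MulAction.orbit ↥(P : Subgroup G) ω) ≤ 3})
    (hΔ1 : 1 ≤ Δ.ncard) (hΔ4 : Δ.ncard ≤ 4)
    (hfree : ∀ ω : Ω, ω ∉ Δ → ∀ g ∈ (P : Subgroup G), g • ω = ω → g = 1)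
    (K : Subgroup G) (hK : K = MulAction.stabilizer G Δ) :
    ∀ g : G, g ∉ K → ¬ 9 ∣ Nat.card ↥(K ⊓ K.map (MulAut.conj g).toMonoidHom) := by
  intro g hg hdvd
  have : Fact (Nat.Prime 3) := ⟨Nat.prime_three⟩
  have hPK : (P : Subgroup G) ≤ K := by
    intro p hp
    rw [hK, MulAction.mem_stabilizer_set_iff_smul_set_subset Δ.toFinite]
    rintro _ ⟨ω, hω, rfl⟩
    rw [hΔ] at hω ⊢
    have h : MulAction.orbit ↥(P : Subgroup G) (p • ω) = MulAction.orbit ↥(P : Subgroup G) ω :=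
      MulAction.orbit_smul (⟨p, hp⟩ : ↥(P : Subgroup G)) ω
    simpa [h] using hω
  obtain ⟨Q₀, hQ₀⟩ := Sylow.exists_subgroup_card_pow_prime (n := 2) 3 hdvd
  let Q : Subgroup G := Q₀.map (Subgroup.subtype _)
  have hQcard : Nat.card Q = 3 ^ 2 :=
    (Subgroup.card_map_of_injective (Subgroup.subtype_injective _)).trans hQ₀
  have hQle : Q ≤ K ⊓ K.map (MulAut.conj g).toMonoidHom := Subgroup.map_subtype_le Q₀
  obtain ⟨k, hkK, hk⟩ :=
    P.exists_conj_mem_of_le_s8 hPK (hQle.trans inf_le_left) (IsPGroup.of_card hQcard)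
  have hsub : ¬ g • Δ ⊆ Δ := by
    rwa [hK, MulAction.mem_stabilizer_set_iff_smul_set_subset Δ.toFinite] at hg
  obtain ⟨ω, hω, hωΔ⟩ := Set.not_subset.mp hsub
  have hinv : ∀ q ∈ Q, ∀ x ∈ g • Δ, q • x ∈ g • Δ := by
    intro q hq x hx
    obtain ⟨l, hl, rfl⟩ := (hQle hq).2
    obtain ⟨y, hy, rfl⟩ := hx
    have hl' : l • Δ = Δ := by simpa [hK] using hl
    refine ⟨l • y, hl' ▸ Set.smul_mem_smul_set hy, ?_⟩
    simp [mul_smul]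
  have hlt : (g • Δ).ncard < Nat.card Q := by
    rw [hQcard, Set.ncard_smul_set]
    omega
  obtain ⟨q, hq, hq1, hqω⟩ := exists_smul_eq_self_of_ncard_le Q (g • Δ) hinv hlt hω
  have hkΔ : k • Δ = Δ := by simpa [hK] using hkK
  have hkω : k⁻¹ • ω ∉ Δ := by
    rwa [← Set.mem_smul_set_iff_inv_smul_mem, hkΔ]
  have h1 := hfree _ hkω _ (hk q hq) (by simp [mul_smul, hqω])
  exact hq1 (by simpa using conj_eq_one_iff (a := k⁻¹) (b := q) |>.mp (by simpa using h1))
end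

section
/- Suppose that the finite group G acts transitively, faithfully and with fixity 4 on a finite set Ω, let P be a Sylow 3-subgroup of G, let Δ denote the union of the P-orbits on Ω of length at most 3, and assume that 1 ≤ |Δ| ≤ 4 and that P acts freely on Ω ∖ Δ. Let K be the setwise stabilizer of Δ in G. Then K controls fusion in P with respect to G: for all a, b ∈ P, if there exists g ∈ G with g⁻¹ag = b, then there exists k ∈ K with k⁻¹ak = b. -/
open Pointwise

/-- If a central element `z` of a Sylow subgroup `P` is conjugated into `P` only by elements of `K`,
then `K` controls fusion in `P`. -/
theorem Sylow.exists_mem_conj_eq_of_central {p : ℕ} [Fact p.Prime] {G : Type*} [Group G] [Finite G]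
    (P : Sylow p G) (K : Subgroup G) {z : G} (hzP : z ∈ P) (hzc : ∀ x ∈ P, x * z = z * x)
    (hzK : ∀ g : G, g⁻¹ * z * g ∈ P → g ∈ K) {a b g : G} (ha : a ∈ P) (hb : b ∈ P)
    (hg : g⁻¹ * a * g = b) : ∃ k ∈ K, k⁻¹ * a * k = b := by
  let C : Subgroup G := Subgroup.centralizer {b}
  have hzC : z ∈ C := Subgroup.mem_centralizer_singleton_iff.2 (hzc b hb).symm
  have hyC : g⁻¹ * z * g ∈ C := by
    rw [Subgroup.mem_centralizer_singleton_iff, ← hg]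
    have := hzc a ha
    calc g⁻¹ * z * g * (g⁻¹ * a * g) = g⁻¹ * (z * a) * g := by group
      _ = g⁻¹ * (a * z) * g := by rw [this]
      _ = _ := by group
  have hz : IsPGroup p (Subgroup.zpowers z) :=
    P.2.to_le ((Subgroup.zpowers_le (H := (P : Subgroup G))).2 hzP)
  obtain ⟨n, hn⟩ := (IsPGroup.iff_card (p := p)).1 hz
  rw [Nat.card_zpowers] at hn
  have hsyl : ∀ x : C, orderOf (x : G) = p ^ n → ∃ S : Sylow p C, x ∈ S := by
    intro x hx
    have hx' : IsPGroup p (Subgroup.zpowers x) :=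
      IsPGroup.of_card (n := n) (by rw [Nat.card_zpowers, ← hx, Subgroup.orderOf_coe])
    obtain ⟨S, hS⟩ := hx'.exists_le_sylow
    exact ⟨S, hS (Subgroup.mem_zpowers x)⟩
  obtain ⟨S, hS⟩ := hsyl ⟨z, hzC⟩ hn
  obtain ⟨T, hT⟩ := hsyl ⟨g⁻¹ * z * g, hyC⟩ (by
    rw [← hn]
    simpa using (MulAut.conj g⁻¹).orderOf_eq z)
  obtain ⟨c, hc⟩ := MulAction.exists_smul_eq C T S
  obtain ⟨R, hR⟩ := (S.2.map C.subtype).exists_le_sylow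
  obtain ⟨h, rfl⟩ := MulAction.exists_smul_eq G P R
  have key : ∀ x : C, x ∈ S → h⁻¹ * x * h ∈ P := by
    intro x hx
    have h1 : (x : G) ∈ h • P := hR ⟨x, hx, rfl⟩
    have h2 : (x : G) ∈ MulAut.conj h • (P : Subgroup G) := h1
    rw [Subgroup.mem_pointwise_smul_iff_inv_smul_mem] at h2
    change h⁻¹ * x * h ∈ (P : Subgroup G)
    simpa [← map_inv] using h2
  have hh : h ∈ K := hzK h (key _ hS)
  have hcS : c * ⟨g⁻¹ * z * g, hyC⟩ * c⁻¹ ∈ S := by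
    rw [← hc]
    change _ ∈ MulAut.conj c • (T : Subgroup C)
    exact Subgroup.smul_mem_pointwise_smul _ (MulAut.conj c) _ hT
  have hgch : g * (c : G)⁻¹ * h ∈ K := by
    apply hzK
    have := key _ hcS
    simpa [mul_assoc] using this
  refine ⟨g * (c : G)⁻¹, (K.mul_mem_cancel_right hh).1 hgch, ?_⟩
  have hcb : (c : G) * b = b * c := Subgroup.mem_centralizer_singleton_iff.1 c.2
  calc (g * (c : G)⁻¹)⁻¹ * a * (g * (c : G)⁻¹) = c * (g⁻¹ * a * g) * (c : G)⁻¹ := by group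
    _ = b := by rw [hg, hcb]; group

/-- A nontrivial normal subgroup of a finite `p`-group contains a nontrivial central element. -/
theorem IsPGroup.exists_mem_center_of_normal {p : ℕ} [Fact p.Prime] {P : Type*} [Group P] [Finite P]
    (hP : IsPGroup p P) (N : Subgroup P) [N.Normal] (hN : N ≠ ⊥) :
    ∃ z ∈ N, z ≠ 1 ∧ ∀ x, x * z = z * x := by
  obtain ⟨n, hn, hcard⟩ := (hP.to_subgroup N).nontrivial_iff_card.1
    ((Subgroup.nontrivial_iff_ne_bot N).2 hN)
  have hfix : (1 : N) ∈ MulAction.fixedPoints (ConjAct P) N := fun x => smul_one x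
  obtain ⟨z, hz, hz1⟩ := IsPGroup.exists_fixed_point_of_prime_dvd_card_of_fixed_point
    (G := ConjAct P) (p := p) (hP.of_equiv ConjAct.toConjAct) N
    (hcard ▸ dvd_pow_self p hn.ne') hfix
  refine ⟨z, z.2, fun h => hz1 (Subtype.ext h.symm), fun x => ?_⟩
  have := congrArg (Subtype.val) (hz (ConjAct.toConjAct x))
  rw [ConjAct.Subgroup.val_conj_smul, ConjAct.smul_def, ConjAct.ofConjAct_toConjAct] at this
  exact mul_inv_eq_iff_eq_mul.1 this

/-- With `G`, `Ω`, `P`, `Δ`, `K` as in the fixity-4 situation where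
`1 ≤ |Δ| ≤ 4` and `P` acts freely on `Ω ∖ Δ`: `K` controls fusion in `P` with respect
to `G`, i.e. elements of `P` that are `G`-conjugate are already `K`-conjugate. -/
theorem stmt_10 {G : Type*} [Group G] [Finite G] {Ω : Type*} [Finite Ω] [MulAction G Ω]
    [MulAction.IsPretransitive G Ω] [FaithfulSMul G Ω]
    (hfix : ∀ g : G, g ≠ 1 → Set.ncard {ω : Ω | g • ω = ω} ≤ 4)
    (hfix4 : ∃ g : G, g ≠ 1 ∧ Set.ncard {ω : Ω | g • ω = ω} = 4)
    (P : Sylow 3 G)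
    (Δ : Set Ω)
    (hΔ : Δ = {ω : Ω | Set.ncard (MulAction.orbit ↥(P : Subgroup G) ω) ≤ 3})
    (hΔ1 : 1 ≤ Δ.ncard) (hΔ4 : Δ.ncard ≤ 4)
    (hfree : ∀ ω : Ω, ω ∉ Δ → ∀ g ∈ (P : Subgroup G), g • ω = ω → g = 1)
    (K : Subgroup G) (hK : K = MulAction.stabilizer G Δ) :
    ∀ a b : G, a ∈ (P : Subgroup G) → b ∈ (P : Subgroup G) →
      (∃ g : G, g⁻¹ * a * g = b) → ∃ k ∈ K, k⁻¹ * a * k = b := by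
  rintro a b ha hb ⟨g, hg⟩
  have : Fact (Nat.Prime 3) := ⟨Nat.prime_three⟩
  by_cases hcard : Nat.card P ≤ 3
  · have hΔu : Δ = Set.univ := by
      rw [hΔ, Set.eq_univ_iff_forall]
      intro ω
      change (MulAction.orbit P ω).ncard ≤ 3
      rw [MulAction.orbit, ← Set.image_univ]
      exact (Set.ncard_image_le (s := Set.univ)).trans ((Set.ncard_univ P).trans_le hcard)
    exact ⟨g, by simp [hK, hΔu], hg⟩
  have hinv : ∀ x : P, ∀ ω ∈ Δ, x • ω ∈ Δ := by
    intro x ω hω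
    rw [hΔ] at hω ⊢
    simpa only [Set.mem_ofPred_eq, MulAction.orbit_smul] using hω
  let A : SubMulAction P Ω := ⟨Δ, fun x {ω} hω => hinv x ω hω⟩
  let f : P →* Equiv.Perm A := MulAction.toPermHom P A
  have hker : f.ker ≠ ⊥ := by
    intro hbot
    have hinj : Function.Injective f := (MonoidHom.ker_eq_bot_iff f).1 hbot
    have hdvd : Nat.card P ∣ Nat.card (Equiv.Perm A) := Subgroup.card_dvd_of_injective f hinj
    have hA : Nat.card A = Δ.ncard := rfl
    rw [Nat.card_perm, hA] at hdvd
    have h24 : Nat.card P ∣ 24 := hdvd.trans (Nat.factorial_dvd_factorial hΔ4)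
    obtain ⟨n, hn⟩ := (IsPGroup.iff_card (p := 3)).1 P.2
    have hn' : Nat.card P = 3 ^ n := hn
    rw [hn'] at h24 hcard
    have hn2 : 2 ≤ n := by
      by_contra! h
      interval_cases n <;> simp at hcard
    have := (pow_dvd_pow 3 hn2).trans h24
    omega
  obtain ⟨z, hzf, hz1, hzc⟩ := P.2.exists_mem_center_of_normal f.ker hker
  have hz1' : (z : G) ≠ 1 := fun h => hz1 (Subtype.ext h)
  have hzfix : ∀ ω ∈ Δ, (z : G) • ω = ω := by
    intro ω hω
    exact congrArg Subtype.val (DFunLike.congr_fun (MonoidHom.mem_ker.1 hzf) (⟨ω, hω⟩ : A))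
  refine P.exists_mem_conj_eq_of_central K z.2
    (fun x hx => congrArg Subtype.val (hzc ⟨x, hx⟩)) (fun x hx => ?_) ha hb hg
  have hsub : x⁻¹ • Δ ⊆ Δ := by
    rintro _ ⟨ω, hω, rfl⟩
    by_contra hnot
    refine hz1' ?_
    have h1 := hfree _ hnot _ hx (by simp [mul_smul, hzfix ω hω])
    simpa [mul_assoc, inv_mul_eq_one, eq_comm] using h1
  have heq : x⁻¹ • Δ = Δ := Set.eq_of_subset_of_ncard_le hsub (by simp)
  rw [hK, ← inv_mem_iff]
  exact heq
end

section
/- Let n ≥ 4 and let P be a finite 3-group of order 3ⁿ and of maximal class, that is, the nilpotency class of P is n − 1. Let U be a subgroup of P of index 3, and suppose that the automorphism group of U contains an element of prime order r with r ≥ 5. Then n = 4, U is elementary abelian (U is abelian of order 27 and every element of U satisfies x³ = 1), r = 13, and U equals the centralizer in P of the second term Z₂ of the upper central series of P. -/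
namespace Subgroup

open scoped commutatorElement

theorem le_of_card_eq_prime_mul {G : Type*} [Group G] [Finite G] {p : ℕ} (hp : p.Prime)
    {H K L : Subgroup G} (hHK : H ≤ K) (hHL : H ≤ L) (hcard : Nat.card K = p * Nat.card H)
    {a : G} (haK : a ∈ K) (haL : a ∈ L) (haH : a ∉ H) : K ≤ L := by
  have hpos : 0 < Nat.card H := Nat.card_pos
  obtain ⟨c, hc⟩ := card_dvd_of_le (le_inf hHK hHL)
  have hdvd : Nat.card (K ⊓ L : Subgroup G) ∣ Nat.card K := card_dvd_of_le inf_le_left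
  rw [hc, hcard, mul_comm] at hdvd
  have hcp : c ∣ p := Nat.dvd_of_mul_dvd_mul_right hpos hdvd
  rcases (Nat.dvd_prime hp).mp hcp with rfl | rfl
  · have : H = K ⊓ L := eq_of_le_of_card_ge (le_inf hHK hHL) (by omega)
    exact absurd (this ▸ ⟨haK, haL⟩) haH
  · have : K ⊓ L = K := eq_of_le_of_card_ge inf_le_left (by rw [hc, hcard, mul_comm])
    exact inf_eq_left.mp this

theorem commutator_mem_of_index_prime {G : Type*} [Group G] [Finite G] {p : ℕ}
    (hp : p.Prime) {U N : Subgroup G} [N.Normal] (hU : U.index = p) {a g : G} (hg : g ∉ U)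
    (hag : ⁅a, g⁆ ∈ N) (haU : ∀ u ∈ U, ⁅a, u⁆ ∈ N) (y : G) : ⁅a, y⁆ ∈ N := by
  let C : Subgroup G := (centralizer {(a : G ⧸ N)}).comap (QuotientGroup.mk' N)
  have hC : ∀ y, y ∈ C ↔ ⁅a, y⁆ ∈ N := by
    intro y
    rw [← QuotientGroup.eq_one_iff (N := N), mem_comap, mem_centralizer_singleton_iff,
      ← QuotientGroup.mk'_apply N ⁅a, y⁆, map_commutatorElement,
      commutatorElement_eq_one_iff_mul_comm]
    exact eq_comm
  have hle : (⊤ : Subgroup G) ≤ C := by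
    refine le_of_card_eq_prime_mul hp (H := U) le_top (fun u hu ↦ (hC u).2 (haU u hu)) ?_
      (mem_top g) ((hC g).2 hag) hg
    rw [card_top, ← hU, mul_comm, U.card_mul_index]
  exact (hC y).1 (hle (mem_top y))

section MaximalClass

variable {P : Type*} [Group P] {p : ℕ} {n : ℕ}

theorem card_upperCentralSeries_lt_of_lt [Finite P] {i j : ℕ} (hij : i < j)
    (hj : j ≤ Group.nilpotencyClass P) :
    Nat.card (upperCentralSeries P i) < Nat.card (upperCentralSeries P j) := by
  have h := upperCentralSeries.StrictMonoOn P (Set.mem_Iic.2 (hij.le.trans hj))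
    (Set.mem_Iic.2 hj) hij
  by_contra! hc
  exact h.ne (eq_of_le_of_card_ge h.le hc)

theorem index_upperCentralSeries_ne_prime [Finite P] [Group.IsNilpotent P]
    (hp : p.Prime) (hn : Group.nilpotencyClass P = n + 2) :
    (upperCentralSeries P (n + 1)).index ≠ p := by
  intro hidx
  have hne : upperCentralSeries P (n + 1) ≠ ⊤ := by
    rw [Ne, upperCentralSeries_eq_top_iff_nilpotencyClass_le]
    omega
  obtain ⟨g, hg⟩ : ∃ g, g ∉ upperCentralSeries P (n + 1) := by
    by_contra! h
    exact hne ((eq_top_iff' _).2 h)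
  refine hg (mem_upperCentralSeries_succ_iff.2 fun y ↦ ?_)
  refine commutator_mem_of_index_prime hp hidx hg (by simp) (fun u hu ↦ ?_) y
  rw [← commutatorElement_inv]
  exact inv_mem (mem_upperCentralSeries_succ_iff.1 hu g)

theorem card_upperCentralSeries_of_maximalClass [Finite P] [Group.IsNilpotent P]
    (hp : p.Prime) (hcard : Nat.card P = p ^ (n + 3))
    (hclass : Group.nilpotencyClass P = n + 2) {i : ℕ} (hi : i ≤ n + 1) :
    Nat.card (upperCentralSeries P i) = p ^ i := by
  have hex : ∀ i, ∃ e, Nat.card (upperCentralSeries P i) = p ^ e := fun i ↦ by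
    obtain ⟨e, -, he⟩ := (Nat.dvd_prime_pow hp).1 (hcard ▸ card_subgroup_dvd_card
      (upperCentralSeries P i))
    exact ⟨e, he⟩
  choose e he using hex
  have hlt : ∀ {i j}, i < j → j ≤ n + 2 → e i < e j := fun hij hj ↦ by
    have := card_upperCentralSeries_lt_of_lt (P := P) hij (hclass ▸ hj)
    rwa [he, he, Nat.pow_lt_pow_iff_right hp.one_lt] at this
  have htop : e (n + 2) = n + 3 := by
    have h := he (n + 2)
    rw [← hclass, upperCentralSeries_nilpotencyClass, card_top, hcard] at h
    rw [← hclass]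
    exact (Nat.pow_right_injective hp.two_le h).symm
  have hsub : e (n + 1) ≤ n + 1 := by
    have h1 := hlt (Nat.lt_succ_self (n + 1)) le_rfl
    have h2 : e (n + 1) ≠ n + 2 := fun h ↦ by
      refine index_upperCentralSeries_ne_prime (P := P) hp hclass ?_
      have h3 := (upperCentralSeries P (n + 1)).card_mul_index
      rw [he, hcard, h, pow_succ p (n + 2)] at h3
      exact Nat.eq_of_mul_eq_mul_left (pow_pos hp.pos _) h3
    simp only [Nat.succ_eq_add_one, add_assoc, Nat.reduceAdd, htop] at h1
    omega
  have hge : ∀ j, j ≤ n + 1 → j ≤ e j := by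
    intro j
    induction j with
    | zero => simp
    | succ j ih => exact fun hj ↦ (ih (by omega)).trans_lt (hlt (Nat.lt_succ_self j) (by omega))
  have hle : ∀ k j, j + k = n + 1 → e j ≤ j := by
    intro k
    induction k with
    | zero => rintro j rfl; exact hsub
    | succ k ih =>
      intro j hj
      have := ih (j + 1) (by omega)
      have := hlt (Nat.lt_succ_self j) (by omega)
      simp only [Nat.succ_eq_add_one] at this
      omega
  rw [he, le_antisymm (hle (n + 1 - i) i (by omega)) (hge i hi)]

theorem exists_mem_upperCentralSeries_succ_of_not_le [Group.IsNilpotent P] {N : Subgroup P}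
    [N.Normal] {i : ℕ}
    (hN : ¬ N ≤ upperCentralSeries P i) :
    ∃ a ∈ N, a ∈ upperCentralSeries P (i + 1) ∧ a ∉ upperCentralSeries P i := by
  have key : ∀ j, ∀ a ∈ N, a ∈ upperCentralSeries P (i + j) → a ∉ upperCentralSeries P i →
      ∃ b ∈ N, b ∈ upperCentralSeries P (i + 1) ∧ b ∉ upperCentralSeries P i := by
    intro j
    induction j with
    | zero => exact fun a _ h h' ↦ absurd h h'
    | succ j ih =>
      intro a haN haj hai
      by_cases h : a ∈ upperCentralSeries P (i + 1)
      · exact ⟨a, haN, h, hai⟩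
      · rw [mem_upperCentralSeries_succ_iff] at h
        push Not at h
        obtain ⟨y, hy⟩ := h
        refine ih ⁅a, y⁆ ?_ (mem_upperCentralSeries_succ_iff.1 haj y) hy
        rw [commutatorElement_def, mul_assoc, mul_assoc, ← mul_assoc y]
        exact mul_mem haN (Normal.conj_mem ‹_› _ (inv_mem haN) y)
  obtain ⟨a, haN, hai⟩ := SetLike.not_le_iff_exists.1 hN
  refine key (Group.nilpotencyClass P) a haN ?_ hai
  have : upperCentralSeries P (i + Group.nilpotencyClass P) = ⊤ :=
    upperCentralSeries_eq_top_iff_nilpotencyClass_le.2 (by omega)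
  rw [this]
  exact mem_top a

theorem upperCentralSeries_succ_le_of_not_le [Finite P] [Group.IsNilpotent P]
    (hp : p.Prime) (hcard : Nat.card P = p ^ (n + 3))
    (hclass : Group.nilpotencyClass P = n + 2) {N : Subgroup P} [N.Normal] {i : ℕ} (hi : i ≤ n)
    (hN : ¬ N ≤ upperCentralSeries P i) : upperCentralSeries P (i + 1) ≤ N := by
  induction i with
  | zero =>
    obtain ⟨a, haN, ha1, ha0⟩ := exists_mem_upperCentralSeries_succ_of_not_le hN
    refine le_of_card_eq_prime_mul hp (upperCentralSeries_mono P (Nat.le_succ 0)) bot_le ?_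
      ha1 haN ha0
    rw [card_upperCentralSeries_of_maximalClass hp hcard hclass (by omega),
      card_upperCentralSeries_of_maximalClass hp hcard hclass (by omega), pow_succ, mul_comm]
  | succ i ih =>
    obtain ⟨a, haN, ha1, ha0⟩ := exists_mem_upperCentralSeries_succ_of_not_le hN
    refine le_of_card_eq_prime_mul hp (upperCentralSeries_mono P (Nat.le_succ (i + 1)))
      (ih (by omega) fun h ↦ hN (h.trans (upperCentralSeries_mono P (Nat.le_succ i)))) ?_
      ha1 haN ha0
    rw [card_upperCentralSeries_of_maximalClass hp hcard hclass (by omega),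
      card_upperCentralSeries_of_maximalClass hp hcard hclass (by omega), pow_succ _ (i + 1),
      mul_comm]


theorem commute_commutatorElement_of_mem_upperCentralSeries_two {z : P}
    (hz : z ∈ upperCentralSeries P 2) (a b : P) : Commute ⁅a, b⁆ z := by
  have hbot : ⁅⁅upperCentralSeries P 2, (⊤ : Subgroup P)⁆, (⊤ : Subgroup P)⁆ = ⊥ := by
    rw [eq_bot_iff]
    exact (commutator_mono (commutator_upperCentralSeries_top_le P 1) le_rfl).trans
      (commutator_upperCentralSeries_top_le P 0)
  have h := commutator_commutator_eq_bot_of_rotate (H₁ := (⊤ : Subgroup P)) (H₂ := ⊤)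
    (H₃ := upperCentralSeries P 2) (by rwa [commutator_comm (⊤ : Subgroup P) (upperCentralSeries P 2)]) hbot
  rw [commute_iff_eq, ← commutatorElement_eq_one_iff_mul_comm, ← mem_bot, ← h]
  exact commutator_mem_commutator (commutator_mem_commutator (mem_top a) (mem_top b)) hz

theorem mul_comm_of_commutatorElement_chain {g u b c : P} (hb : ⁅g, u⁆ = b) (hc : ⁅g, b⁆ = c)
    (hub : ⁅u, b⁆ ∈ center P) (hbc : Commute b c) : u * c = c * u := by
  have hgu : g * u * g⁻¹ = b * u := by rw [← hb, commutatorElement_def]; group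
  have hgb : g * b * g⁻¹ = c * b := by rw [← hc, commutatorElement_def]; group
  obtain ⟨z, hz⟩ : ∃ z, ⁅u, b⁆ = z := ⟨_, rfl⟩
  rw [hz, mem_center_iff] at hub
  have hubz : u * b = z * (b * u) := by rw [← hz, commutatorElement_def]; group
  have h : b * u * (c * b) = b * (c * (u * b)) := calc
    b * u * (c * b) = g * (u * b) * g⁻¹ := by rw [← hgu, ← hgb]; group
    _ = g * z * (b * u) * g⁻¹ := by rw [hubz]; group
    _ = z * ((g * b * g⁻¹) * (g * u * g⁻¹)) := by rw [hub]; group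
    _ = z * (c * b) * (b * u) := by rw [hgu, hgb]; group
    _ = c * b * (z * (b * u)) := by rw [← hub]; group
    _ = b * (c * (u * b)) := by rw [← hubz, ← hbc.eq]; group
  rw [mul_assoc] at h
  have h' := mul_left_cancel h
  rw [← mul_assoc, ← mul_assoc] at h'
  exact mul_right_cancel h'

theorem eq_one_of_conj_chain_of_pow_three {a b c d : P} (hda : d * a = b * a * d)
    (hdb : d * b = c * b * d) (hab : Commute a b) (hac : Commute a c) (hbc : Commute b c)
    (ha : a ^ 3 = 1) (hb : b ^ 3 = 1) (hd : d ^ 3 = 1) (had : (a * d) ^ 3 = 1) : c = 1 := by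
  have h : (a * d) ^ 3 = a * b * (a * c) * b * (b * a) * d ^ 3 := calc
    (a * d) ^ 3 = a * (d * a) * (d * a) * d := by simp only [pow_succ, pow_zero, one_mul, mul_assoc]
    _ = a * b * a * (d * b) * a * d * d := by rw [hda]; simp only [mul_assoc]
    _ = a * b * (a * c) * b * (d * a) * d * d := by rw [hdb]; simp only [mul_assoc]
    _ = a * b * (a * c) * b * (b * a) * d ^ 3 := by
      rw [hda]; simp only [pow_succ, pow_zero, one_mul, mul_assoc]
  rw [had, hd, mul_one] at h
  have h2 : a * b * (a * c) * b * (b * a) = c * (a ^ 3 * b ^ 3) := by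
    simp only [pow_succ, pow_zero, one_mul, mul_assoc, hab.symm.eq, hab.symm.left_comm, hac.eq,
      hac.left_comm, hbc.left_comm]
  rw [h2, ha, hb] at h
  simpa using h.symm

theorem commutatorElement_not_mem_upperCentralSeries [Finite P] (hp : p.Prime) {U : Subgroup P}
    (hU : U.index = p) (hcomm : ∀ u ∈ U, ∀ v ∈ U, ⁅u, v⁆ ∈ upperCentralSeries P 1) {g a : P}
    (hg : g ∉ U) (ha : a ∈ U) (hn : 1 ≤ n) (han : a ∉ upperCentralSeries P (n + 1)) :
    ⁅g, a⁆ ∉ upperCentralSeries P n := by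
  refine fun h ↦ han (mem_upperCentralSeries_succ_iff.2 fun y ↦ ?_)
  refine commutator_mem_of_index_prime hp hU hg ?_
    (fun v hv ↦ upperCentralSeries_mono P hn (hcomm a ha v hv)) y
  rw [← commutatorElement_inv]
  exact inv_mem h

theorem upperCentralSeries_succ_le_of_mem [Finite P] [Group.IsNilpotent P]
    (hp : p.Prime) (hcard : Nat.card P = p ^ (n + 3)) (hclass : Group.nilpotencyClass P = n + 2)
    {L : Subgroup P} {i : ℕ} (hi : i ≤ n) (hL : upperCentralSeries P i ≤ L) {a : P}
    (ha : a ∈ upperCentralSeries P (i + 1)) (haL : a ∈ L) (ha' : a ∉ upperCentralSeries P i) :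
    upperCentralSeries P (i + 1) ≤ L := by
  refine le_of_card_eq_prime_mul hp (upperCentralSeries_mono P (Nat.le_succ i)) hL ?_ ha haL ha'
  rw [card_upperCentralSeries_of_maximalClass hp hcard hclass (by omega),
    card_upperCentralSeries_of_maximalClass hp hcard hclass (by omega), pow_succ _ i, mul_comm]

theorem not_elementary_mod_center_of_card_eq [Finite P] [Group.IsNilpotent P]
    (hcard : Nat.card P = 3 ^ 5) (hclass : Group.nilpotencyClass P = 4) {U : Subgroup P}
    (hU : U.index = 3) (hcomm : ∀ u ∈ U, ∀ v ∈ U, ⁅u, v⁆ ∈ upperCentralSeries P 1)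
    (hcube : ∀ u ∈ U, u ^ 3 ∈ upperCentralSeries P 1) : False := by
  have hp : Nat.Prime 3 := Nat.prime_three
  have hUnormal : U.Normal := by
    refine normal_of_index_eq_minFac_card ?_
    rw [hU, hcard, Nat.pow_minFac (by norm_num), hp.minFac_eq]
  have hUcard : Nat.card U = 3 ^ 4 := by
    have := U.card_mul_index
    rw [hU, hcard] at this
    omega
  have hZcard : ∀ i ≤ 3, Nat.card (upperCentralSeries P i) = 3 ^ i := fun i hi ↦
    card_upperCentralSeries_of_maximalClass (n := 2) hp hcard hclass hi
  have hUZ : ∀ i ≤ 3, ¬ U ≤ upperCentralSeries P i := by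
    intro i hi h
    have := card_le_of_le h
    rw [hUcard, hZcard i hi] at this
    exact absurd ((Nat.pow_le_pow_iff_right (by norm_num)).1 this) (by omega)
  have hZU : ∀ i ≤ 3, upperCentralSeries P i ≤ U := fun i hi ↦
    (upperCentralSeries_mono P hi).trans (upperCentralSeries_succ_le_of_not_le (n := 2) hp hcard
      hclass le_rfl (hUZ 2 (by norm_num)))
  obtain ⟨u, hu, hu3⟩ := SetLike.not_le_iff_exists.1 (hUZ 3 le_rfl)
  have hZ4 : upperCentralSeries P 4 = ⊤ := hclass ▸ upperCentralSeries_nilpotencyClass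
  have hmem : ∀ (i : ℕ) (a g : P), a ∈ upperCentralSeries P (i + 1) → ⁅g, a⁆ ∈ upperCentralSeries P i := by
    intro i a g ha
    rw [← commutatorElement_inv]
    exact inv_mem (mem_upperCentralSeries_succ_iff.1 ha g)
  have hb : ∀ g, ⁅g, u⁆ ∈ upperCentralSeries P 3 := fun g ↦ hmem 3 u g (hZ4 ▸ mem_top u)
  have hb' : ∀ g ∉ U, ⁅g, u⁆ ∉ upperCentralSeries P 2 := fun g hg ↦
    commutatorElement_not_mem_upperCentralSeries hp hU hcomm hg hu (by norm_num) hu3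
  have hc : ∀ g, ⁅g, ⁅g, u⁆⁆ ∈ upperCentralSeries P 2 := fun g ↦ hmem 2 _ g (hb g)
  have hc' : ∀ g ∉ U, ⁅g, ⁅g, u⁆⁆ ∉ upperCentralSeries P 1 := fun g hg ↦
    commutatorElement_not_mem_upperCentralSeries hp hU hcomm hg (hZU 3 le_rfl (hb g)) le_rfl
      (hb' g hg)
  have hpow : ∀ g ∉ U, g ^ 3 ∈ upperCentralSeries P 1 := by
    intro g hg
    have hgU : g ^ 3 ∈ U := hU ▸ U.pow_index_mem g
    have hg2 : g ^ 3 ∈ upperCentralSeries P 2 := by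
      refine mem_upperCentralSeries_succ_iff.2 fun y ↦ commutator_mem_of_index_prime hp hU hg ?_
        (fun v hv ↦ hcomm _ hgU v hv) y
      rw [commutatorElement_eq_one_iff_mul_comm.2 (Commute.pow_self g 3).eq]
      exact one_mem _
    have hcentral : ∀ a, upperCentralSeries P 1 ≤ centralizer {a} := fun a ↦ by
      rw [upperCentralSeries_one]
      exact center_le_centralizer _
    have huc : ⁅g, ⁅g, u⁆⁆ ∈ centralizer {u} := by
      rw [mem_centralizer_singleton_iff]
      refine (mul_comm_of_commutatorElement_chain rfl rfl ?_
        (commute_commutatorElement_of_mem_upperCentralSeries_two (hc g) _ _)).symm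
      rw [← upperCentralSeries_one]
      exact hcomm _ hu _ (hZU 3 le_rfl (hb g))
    have hug : g ^ 3 * u = u * g ^ 3 := mem_centralizer_singleton_iff.1
      (upperCentralSeries_succ_le_of_mem (n := 2) hp hcard hclass (by norm_num) (hcentral u) (hc g)
        huc (hc' g hg) hg2)
    have hcom : ∀ a b, ⁅a, b⁆ ∈ centralizer {g ^ 3} := fun a b ↦ mem_centralizer_singleton_iff.2
      (commute_commutatorElement_of_mem_upperCentralSeries_two hg2 a b)
    have h2 := upperCentralSeries_succ_le_of_mem (n := 2) hp hcard hclass (by norm_num)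
      (hcentral (g ^ 3)) (hc g) (hcom _ _) (hc' g hg)
    have h3 := upperCentralSeries_succ_le_of_mem (n := 2) hp hcard hclass (by norm_num) h2 (hb g)
      (hcom _ _) (hb' g hg)
    have h4 : U ≤ centralizer {g ^ 3} := by
      refine le_of_card_eq_prime_mul hp (hZU 3 le_rfl) h3 ?_ hu
        (mem_centralizer_singleton_iff.2 hug.symm) hu3
      rw [hUcard, hZcard 3 le_rfl]
      norm_num
    have h5 : (⊤ : Subgroup P) ≤ centralizer {g ^ 3} := by
      refine le_of_card_eq_prime_mul hp le_top h4 ?_ (mem_top g)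
        (mem_centralizer_singleton_iff.2 (Commute.self_pow g 3).eq) hg
      rw [card_top, hcard, hUcard]
      norm_num
    rw [upperCentralSeries_one, mem_center_iff]
    exact fun y ↦ mem_centralizer_singleton_iff.1 (h5 (mem_top y))
  obtain ⟨g, hg⟩ : ∃ g, g ∉ U := by
    by_contra! h
    rw [(eq_top_iff' U).2 h, index_top] at hU
    omega
  have hug : u * g ∉ U := fun h ↦ hg ((U.mul_mem_cancel_left hu).1 h)
  simp only [upperCentralSeries_one] at hcomm hcube hpow hc'
  let π := QuotientGroup.mk' (center P)
  have hπ : ∀ x, π x = 1 ↔ x ∈ center P := fun x ↦ QuotientGroup.eq_one_iff x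
  have hbU := hZU 3 le_rfl (hb g)
  have hcU := hZU 2 (by norm_num) (hc g)
  have hπc : ∀ x ∈ U, ∀ y ∈ U, Commute (π x) (π y) := fun x hx y hy ↦ by
    rw [commute_iff_eq, ← commutatorElement_eq_one_iff_mul_comm, ← map_commutatorElement, hπ]
    exact hcomm x hx y hy
  refine hc' g hg ((hπ _).1 (eq_one_of_conj_chain_of_pow_three (a := π u) (b := π ⁅g, u⁆)
    (d := π g) ?_ ?_ (hπc _ hu _ hbU) (hπc _ hu _ hcU) (hπc _ hbU _ hcU) ?_ ?_ ?_ ?_))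
  · simp only [← map_mul, commutatorElement_def]
    congr 1
    group
  · simp only [← map_mul, commutatorElement_def]
    congr 1
    group
  · rw [← map_pow, hπ]; exact hcube u hu
  · rw [← map_pow, hπ]; exact hcube _ hbU
  · rw [← map_pow, hπ]; exact hpow g hg
  · rw [← map_mul, ← map_pow, hπ]; exact hpow _ hug

end MaximalClass


theorem not_elementary_mod_upperCentralSeries {P : Type*} [Group P] [Finite P]
    [Group.IsNilpotent P] {k : ℕ} (hcard : Nat.card P = 3 ^ (k + 5))
    (hclass : Group.nilpotencyClass P = k + 4) {U : Subgroup P} (hU : U.index = 3)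
    (hcomm : ∀ u ∈ U, ∀ v ∈ U, ⁅u, v⁆ ∈ upperCentralSeries P (k + 1))
    (hcube : ∀ u ∈ U, u ^ 3 ∈ upperCentralSeries P (k + 1)) : False := by
  induction k generalizing P with
  | zero => exact not_elementary_mod_center_of_card_eq hcard hclass hU hcomm hcube
  | succ k ih =>
    have hp : Nat.Prime 3 := Nat.prime_three
    have hZ : Nat.card (center P) = 3 := by
      have := card_upperCentralSeries_of_maximalClass (n := k + 3) (i := 1) hp hcard hclass
        (by omega)
      rwa [upperCentralSeries_one, pow_one] at this
    have hUnormal : U.Normal := by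
      refine normal_of_index_eq_minFac_card ?_
      rw [hU, hcard, Nat.pow_minFac (by omega), hp.minFac_eq]
    have hZU : center P ≤ U := by
      rw [← upperCentralSeries_one]
      refine upperCentralSeries_succ_le_of_not_le (n := k + 3) (i := 0) hp hcard hclass
        (by omega) fun h ↦ ?_
      rw [upperCentralSeries_zero, le_bot_iff] at h
      rw [h, index_bot, hcard] at hU
      have h2 : (3 : ℕ) ^ (k + 1 + 5) = 3 ^ 1 := by simpa using hU
      have := Nat.pow_right_injective (by norm_num : 2 ≤ 3) h2
      omega
    have hmk : ∀ x : P, x ∈ upperCentralSeries P (k + 1 + 1) →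
        QuotientGroup.mk' (center P) x ∈ upperCentralSeries (P ⧸ center P) (k + 1) := fun x hx ↦ by
      rwa [← mem_comap, comap_upperCentralSeries_quotient_center]
    refine ih (P := P ⧸ center P) ?_ ?_ (U := U.map (QuotientGroup.mk' (center P))) ?_ ?_ ?_
    · have := (center P).card_eq_card_quotient_mul_card_subgroup
      rw [hcard, hZ, show k + 1 + 5 = (k + 5) + 1 by ring, pow_succ] at this
      exact (Nat.eq_of_mul_eq_mul_right (by norm_num) this).symm
    · rw [Group.nilpotencyClass_quotient_center, hclass]
      omega
    · rwa [index_map_eq _ (QuotientGroup.mk'_surjective _) (by rwa [QuotientGroup.ker_mk'])]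
    · rintro _ ⟨u, hu, rfl⟩ _ ⟨v, hv, rfl⟩
      rw [← map_commutatorElement]
      exact hmk _ (hcomm u hu v hv)
    · rintro _ ⟨u, hu, rfl⟩
      rw [← map_pow]
      exact hmk _ (hcube u hu)

theorem commutator_mem_and_pow_mem_of_isCoatom {V : Type*} [Group V] [Finite V] {p : ℕ}
    [Fact p.Prime] (hV : IsPGroup p V) {M : Subgroup V} (hM : IsCoatom M) :
    (∀ u v : V, ⁅u, v⁆ ∈ M) ∧ ∀ u : V, u ^ p ∈ M := by
  have hp : p.Prime := Fact.out
  have hnil := hV.isNilpotent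
  have hnormal : M.Normal := NormalizerCondition.normal_of_coatom M
    Group.normalizerCondition_of_isNilpotent hM
  have hidx : M.index = p := by
    obtain ⟨m, hm⟩ := IsPGroup.iff_card.1 hV
    obtain ⟨k, hk⟩ := IsPGroup.iff_card.1 (hV.to_subgroup M)
    have hlt : k < m := by
      refine lt_of_not_ge fun h ↦ hM.1 (eq_top_of_le_card _ ?_)
      rw [hk, hm]
      exact Nat.pow_le_pow_right hp.pos h
    obtain ⟨K, hK, hMK⟩ := Sylow.exists_subgroup_card_pow_succ
      (hm ▸ pow_dvd_pow p (Nat.succ_le_of_lt hlt)) hk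
    have hne : M ≠ K := fun h ↦ by
      rw [← h, hk] at hK
      have := Nat.pow_right_injective hp.two_le hK
      omega
    have hKtop := hM.2 K (lt_of_le_of_ne hMK hne)
    rw [hKtop, card_top, ← M.card_mul_index, hk, pow_succ] at hK
    exact Nat.eq_of_mul_eq_mul_left (pow_pos hp.pos k) hK
  refine ⟨fun u v ↦ ?_, fun u ↦ hidx ▸ M.pow_index_mem u⟩
  have hcyc : IsCyclic (V ⧸ M) := isCyclic_of_prime_card (p := p) hidx
  rw [← QuotientGroup.eq_one_iff, ← QuotientGroup.mk'_apply, map_commutatorElement,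
    commutatorElement_eq_one_iff_mul_comm]
  exact hcyc.commGroup.mul_comm _ _

theorem commutator_mem_frattini {V : Type*} [Group V] [Finite V] {p : ℕ} [Fact p.Prime]
    (hV : IsPGroup p V) (u v : V) : ⁅u, v⁆ ∈ frattini V := by
  simp only [frattini, Order.radical, mem_iInf]
  exact fun M hM ↦ (commutator_mem_and_pow_mem_of_isCoatom hV hM).1 u v

theorem pow_mem_frattini {V : Type*} [Group V] [Finite V] {p : ℕ} [Fact p.Prime]
    (hV : IsPGroup p V) (u : V) : u ^ p ∈ frattini V := by
  simp only [frattini, Order.radical, mem_iInf]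
  exact fun M hM ↦ (commutator_mem_and_pow_mem_of_isCoatom hV hM).2 u

end Subgroup

theorem Equiv.Perm.natCard_modEq_natCard_fixed {α : Type*} [Finite α] {r : ℕ} (hr : r.Prime)
    {σ : Equiv.Perm α} (hσ : σ ^ r = 1) : Nat.card α ≡ Nat.card {x // σ x = x} [MOD r] := by
  classical
  have := Fact.mk hr
  have := Fintype.ofFinite α
  have h := Equiv.Perm.card_compl_support_modEq (p := r) (n := 1) (σ := σ) (by rwa [pow_one])
  have hcard : Nat.card {x // σ x = x} = σ.supportᶜ.card := by
    rw [Nat.card_eq_fintype_card, Fintype.card_subtype]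
    congr 1
    ext x
    simp
  rw [hcard, Nat.card_eq_fintype_card]
  exact h.symm

namespace MulAut

variable {V : Type*} [Group V] {r : ℕ}

theorem toPerm_subtypePerm_pow_eq_one {ψ : MulAut V} (hψ : ψ ^ r = 1) {Q : V → Prop}
    (hQ : ∀ x, Q (MulAut.toPerm V ψ x) ↔ Q x) : ((MulAut.toPerm V ψ).subtypePerm hQ) ^ r = 1 := by
  rw [Equiv.Perm.subtypePerm_pow]
  ext y
  change ((MulAut.toPerm V ψ) ^ r) y.1 = y.1
  rw [← map_pow, hψ]
  rfl

variable [Finite V]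

theorem eq_one_or_fixedPointFree_of_card_eq (hr : r.Prime) (hr5 : 5 ≤ r) {d : ℕ} (hd : d ≤ 3)
    (hcard : Nat.card V = 3 ^ d) {ψ : MulAut V} (hψ : ψ ^ r = 1) :
    ψ = 1 ∨ d = 3 ∧ r = 13 ∧ ∀ x, ψ x = x → x = 1 := by
  let F : Subgroup V := ψ.toMonoidHom.eqLocus (MonoidHom.id V)
  have hF : ∀ x, x ∈ F ↔ ψ x = x := fun x ↦ Iff.rfl
  obtain ⟨k, hk, hFk⟩ := (Nat.dvd_prime_pow Nat.prime_three).1 (hcard ▸ F.card_subgroup_dvd_card)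
  have hmod : 3 ^ k ≡ 3 ^ d [MOD r] := by
    rw [← hcard, ← hFk]
    refine (Equiv.Perm.natCard_modEq_natCard_fixed hr (σ := MulAut.toPerm V ψ) ?_).symm
    rw [← map_pow, hψ, map_one]
  have hdvd := (Nat.modEq_iff_dvd' (Nat.pow_le_pow_right (by norm_num) hk)).1 hmod
  by_cases hkd : k = d
  · left
    have htop : F = ⊤ := Subgroup.eq_top_of_card_eq F (by rw [hFk, hcard, hkd])
    ext x
    exact (hF x).1 (htop ▸ Subgroup.mem_top x)
  · right
    have hlt : k < d := lt_of_le_of_ne hk hkd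
    have hsplit : 3 ^ d - 3 ^ k = 3 ^ k * (3 ^ (d - k) - 1) := by
      rw [Nat.mul_sub, ← pow_add, Nat.add_sub_cancel' hk, mul_one]
    rw [hsplit] at hdvd
    have hr3 : ¬ r ∣ 3 ^ k := fun h ↦ by
      have := Nat.le_of_dvd (by norm_num) (hr.dvd_of_dvd_pow h)
      omega
    have h1 := (hr.dvd_mul.1 hdvd).resolve_left hr3
    have h8 : ¬ r ∣ 2 ^ 3 := fun h ↦ by
      have := Nat.le_of_dvd (by norm_num) (hr.dvd_of_dvd_pow h)
      omega
    have hdk : d - k = 3 := by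
      have : d - k ≤ 3 := by omega
      interval_cases h : d - k
      · omega
      · exact absurd (h1.trans (by norm_num)) h8
      · exact absurd (h1.trans (by norm_num)) h8
      · rfl
    obtain rfl : k = 0 := by omega
    rw [hdk] at h1
    refine ⟨by omega, ?_, fun x hx ↦ ?_⟩
    · rcases hr.dvd_mul.1 (show r ∣ 2 * 13 from h1) with h | h
      · have := Nat.le_of_dvd (by norm_num) h
        omega
      · exact (Nat.prime_dvd_prime_iff_eq hr (by norm_num)).1 h
    · rw [pow_zero, Subgroup.card_eq_one] at hFk
      exact Subgroup.mem_bot.1 (hFk ▸ (hF x).2 hx)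

theorem eq_one_of_card_quotient_frattini (hV : IsPGroup 3 V) (hr : r.Prime) (hr5 : 5 ≤ r)
    (hindex : (frattini V).index ∣ 9) {ψ : MulAut V} (hψ : ψ ^ r = 1) : ψ = 1 := by
  let Φ := frattini V
  have hmap : ∀ χ : MulAut V, Φ.map χ.toMonoidHom = Φ := fun χ ↦
    Subgroup.characteristic_iff_map_eq.1 frattini_characteristic χ
  let ψ' : MulAut (V ⧸ Φ) := QuotientGroup.congr Φ Φ ψ (hmap ψ)
  have hψ'mk : ∀ x : V, ψ' (x : V ⧸ Φ) = (ψ x : V) := fun x ↦ rfl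
  have hψ'pow : ∀ (m : ℕ) (x : V), (ψ' ^ m) (x : V ⧸ Φ) = ((ψ ^ m) x : V) := by
    intro m
    induction m with
    | zero => exact fun x ↦ rfl
    | succ m ih => intro x; rw [pow_succ, pow_succ, MulAut.mul_apply, MulAut.mul_apply, hψ'mk, ih]
  have hψ' : ψ' ^ r = 1 := by
    ext x
    induction x using QuotientGroup.induction_on with
    | H x => rw [hψ'pow, hψ]; rfl
  obtain ⟨d, hd, hdcard⟩ := (Nat.dvd_prime_pow (m := 2) Nat.prime_three).1
    (show Nat.card (V ⧸ Φ) ∣ 3 ^ 2 from hindex)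
  have hψ'1 : ψ' = 1 := (eq_one_or_fixedPointFree_of_card_eq hr hr5 (hd.trans (by norm_num))
    hdcard hψ').resolve_right fun h ↦ by omega
  let F : Subgroup V := ψ.toMonoidHom.eqLocus (MonoidHom.id V)
  have hFΦ : F ⊔ Φ = ⊤ := by
    rw [Subgroup.eq_top_iff']
    intro x
    have hcoset : ∀ y : V, (y : V ⧸ Φ) = x ↔ (ψ y : V ⧸ Φ) = x := fun y ↦ by
      rw [← hψ'mk, hψ'1]; rfl
    let σ : Equiv.Perm {y : V // (y : V ⧸ Φ) = x} := (MulAut.toPerm V ψ).subtypePerm fun y ↦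
      (hcoset y).symm
    have hσ : σ ^ r = 1 := toPerm_subtypePerm_pow_eq_one hψ _
    have hcard : Nat.card {y : V // (y : V ⧸ Φ) = x} = Nat.card Φ := by
      refine Nat.card_congr ⟨fun y ↦ ⟨x⁻¹ * y.1, QuotientGroup.eq.1 y.2.symm⟩,
        fun z ↦ ⟨x * z.1, (QuotientGroup.eq.2 (by simp)).symm⟩, fun y ↦ by simp, fun z ↦ by simp⟩
    have hndvd : ¬ r ∣ Nat.card {y : V // (y : V ⧸ Φ) = x} := by
      have := Fact.mk Nat.prime_three
      obtain ⟨k, hk⟩ := IsPGroup.iff_card.1 (hV.to_subgroup Φ)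
      rw [hcard, hk]
      intro h
      have := Nat.le_of_dvd (by norm_num) (hr.dvd_of_dvd_pow h)
      omega
    have hne : Nat.card {y // σ y = y} ≠ 0 := fun h0 ↦ by
      have h := Equiv.Perm.natCard_modEq_natCard_fixed hr hσ
      rw [h0] at h
      exact hndvd (Nat.modEq_zero_iff_dvd.1 h)
    obtain ⟨⟨y, hyx⟩, hy⟩ := (Nat.card_ne_zero.1 hne).1
    have hyF : y ∈ F := congrArg Subtype.val hy
    have : x = y * (y⁻¹ * x) := by group
    rw [this]
    exact Subgroup.mul_mem_sup hyF (QuotientGroup.eq.1 hyx)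
  have hF := frattini_nongenerating hFΦ
  ext x
  exact (hF ▸ Subgroup.mem_top x : x ∈ F)

theorem characteristic_eq_top_of_card_eq_twentySeven (hr : r.Prime) (hr5 : 5 ≤ r)
    (hcard : Nat.card V = 27) {ψ : MulAut V} (hψ : ψ ^ r = 1) (hψ1 : ψ ≠ 1) {H : Subgroup V}
    (hH : ∀ x, ψ x ∈ H ↔ x ∈ H) (hne : H ≠ ⊥) : H = ⊤ := by
  obtain ⟨-, rfl, hfree⟩ := (eq_one_or_fixedPointFree_of_card_eq hr hr5 le_rfl
    (show Nat.card V = 3 ^ 3 from hcard) hψ).resolve_left hψ1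
  let σ : Equiv.Perm {x // x ∈ H} := (MulAut.toPerm V ψ).subtypePerm hH
  have hσ : σ ^ 13 = 1 := toPerm_subtypePerm_pow_eq_one hψ _
  have hone : Nat.card {x // σ x = x} = 1 := by
    rw [Nat.card_eq_one_iff_unique]
    refine ⟨⟨fun x y ↦ Subtype.ext (Subtype.ext ?_)⟩, ⟨⟨1, Subtype.ext (map_one ψ)⟩⟩⟩
    rw [hfree _ (congrArg Subtype.val x.2), hfree _ (congrArg Subtype.val y.2)]
  have hmod := Equiv.Perm.natCard_modEq_natCard_fixed hr hσ
  rw [hone] at hmod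
  obtain ⟨k, hk, hHk⟩ := (Nat.dvd_prime_pow (m := 3) Nat.prime_three).1
    (show Nat.card H ∣ 3 ^ 3 from (show (3 : ℕ) ^ 3 = 27 by norm_num) ▸
      hcard ▸ H.card_subgroup_dvd_card)
  change Nat.card H ≡ 1 [MOD 13] at hmod
  rw [hHk] at hmod
  interval_cases k
  · rw [pow_zero, Subgroup.card_eq_one] at hHk
    exact absurd hHk hne
  · exact absurd hmod (by decide)
  · exact absurd hmod (by decide)
  · exact Subgroup.eq_top_of_card_eq H (by rw [hHk, hcard]; norm_num)

theorem elementary_of_card_eq_twentySeven (hr : r.Prime) (hr5 : 5 ≤ r)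
    (hcard : Nat.card V = 27) {ψ : MulAut V} (hψ : ψ ^ r = 1) (hψ1 : ψ ≠ 1) :
    (∀ x y : V, x * y = y * x) ∧ ∀ x : V, x ^ 3 = 1 := by
  have := Fact.mk Nat.prime_three
  have hV : IsPGroup 3 V := IsPGroup.of_card (n := 3) hcard
  have hnt : Nontrivial V := Finite.one_lt_card_iff_nontrivial.1 (by omega)
  have hcenter : Subgroup.center V = ⊤ := by
    refine characteristic_eq_top_of_card_eq_twentySeven hr hr5 hcard hψ hψ1 (fun x ↦ ?_)
      hV.bot_lt_center.ne'
    have h := Subgroup.Characteristic.fixed (H := Subgroup.center V) inferInstance ψ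
    exact (SetLike.ext_iff.1 h x)
  have hcomm : ∀ x y : V, x * y = y * x := fun x y ↦
    (Subgroup.mem_center_iff.1 (hcenter ▸ Subgroup.mem_top y) x)
  refine ⟨hcomm, ?_⟩
  let H : Subgroup V :=
    { carrier := {x | x ^ 3 = 1}
      one_mem' := one_pow 3
      mul_mem' := fun {x y} hx hy ↦ by
        change (x * y) ^ 3 = 1
        rw [(show Commute x y from hcomm x y).mul_pow, hx, hy, one_mul]
      inv_mem' := fun {x} hx ↦ by
        change x⁻¹ ^ 3 = 1
        rw [inv_pow, hx, inv_one] }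
  have hmem : ∀ x, x ∈ H ↔ x ^ 3 = 1 := fun x ↦ Iff.rfl
  have hH : H = ⊤ := by
    refine characteristic_eq_top_of_card_eq_twentySeven hr hr5 hcard hψ hψ1 (fun x ↦ ?_) ?_
    · rw [hmem, hmem, ← map_pow, EmbeddingLike.map_eq_one_iff]
    · obtain ⟨x, hx⟩ := exists_prime_orderOf_dvd_card' 3 (G := V) (by rw [hcard]; norm_num)
      intro h
      have hxH : x ∈ H := (hmem x).2 (by rw [← hx]; exact pow_orderOf_eq_one x)
      rw [h, Subgroup.mem_bot] at hxH
      rw [hxH, orderOf_one] at hx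
      omega
  exact fun x ↦ (hmem x).1 (hH ▸ Subgroup.mem_top x)

end MulAut


/-- Let `P` be a finite 3-group of order `3^n` (`n ≥ 4`) of
maximal class (nilpotency class `n - 1`), let `U ≤ P` have index 3, and suppose that
`Aut(U)` has an element of prime order `r ≥ 5`.  Then `n = 4`, `U` is elementary
abelian of order 27, `r = 13`, and `U = C_P(Z₂)`, the centralizer of the second term
of the upper central series of `P`. -/
theorem stmt_12 {P : Type*} [Group P] [Finite P] [Group.IsNilpotent P]
    (n : ℕ) (hn : 4 ≤ n) (hcard : Nat.card P = 3 ^ n)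
    (hclass : Group.nilpotencyClass P = n - 1)
    (U : Subgroup P) (hU : U.index = 3)
    (r : ℕ) (hr : r.Prime) (hr5 : 5 ≤ r)
    (φ : MulAut ↥U) (hφ : orderOf φ = r) :
    n = 4 ∧ (∀ x y : ↥U, x * y = y * x) ∧ Nat.card ↥U = 27 ∧ (∀ x : ↥U, x ^ 3 = 1)
      ∧ r = 13 ∧ U = Subgroup.centralizer (upperCentralSeries P 2 : Set P) := by
  have hp := Nat.prime_three
  have := Fact.mk hp
  have hφr : φ ^ r = 1 := hφ ▸ pow_orderOf_eq_one φ
  have hφ1 : φ ≠ 1 := by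
    rintro rfl
    rw [orderOf_one] at hφ
    omega
  have hUnormal : U.Normal := by
    refine Subgroup.normal_of_index_eq_minFac_card ?_
    rw [hU, hcard, Nat.pow_minFac (by omega), hp.minFac_eq]
  obtain ⟨k, rfl⟩ : ∃ k, n = k + 4 := ⟨n - 4, by omega⟩
  have hclass' : Group.nilpotencyClass P = k + 1 + 2 := hclass
  have hUcard : Nat.card U = 3 ^ (k + 3) := by
    have := U.card_mul_index
    rw [hU, hcard, pow_succ 3 (k + 3)] at this
    exact Nat.eq_of_mul_eq_mul_right (by norm_num) this
  have hUp : IsPGroup 3 U := IsPGroup.of_card hUcard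
  have hZcard : ∀ i ≤ k + 2, Nat.card (Subgroup.upperCentralSeries P i) = 3 ^ i := fun i hi ↦
    Subgroup.card_upperCentralSeries_of_maximalClass hp hcard hclass' hi
  rcases k with _ | k
  · have hU27 : Nat.card U = 27 := hUcard
    obtain ⟨hcomm, hcube⟩ := MulAut.elementary_of_card_eq_twentySeven hr hr5 hU27 hφr hφ1
    obtain ⟨-, hr13, -⟩ := (MulAut.eq_one_or_fixedPointFree_of_card_eq hr hr5 le_rfl hUcard
      hφr).resolve_left hφ1
    refine ⟨rfl, hcomm, hU27, hcube, hr13, ?_⟩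
    have hZU : Subgroup.upperCentralSeries P 2 ≤ U := by
      refine Subgroup.upperCentralSeries_succ_le_of_not_le hp hcard hclass' le_rfl fun h ↦ ?_
      have := Subgroup.card_le_of_le h
      rw [hUcard, hZcard _ (by norm_num)] at this
      norm_num at this
    have hle : U ≤ Subgroup.centralizer (Subgroup.upperCentralSeries P 2 : Set P) := fun u hu ↦
      Subgroup.mem_centralizer_iff.2 fun z hz ↦ congrArg Subtype.val (hcomm ⟨z, hZU hz⟩ ⟨u, hu⟩)
    refine le_antisymm hle fun x hx ↦ ?_
    by_contra hxU
    have htop : (⊤ : Subgroup P) ≤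
        Subgroup.centralizer (Subgroup.upperCentralSeries P 2 : Set P) := by
      refine Subgroup.le_of_card_eq_prime_mul hp le_top hle ?_ (Subgroup.mem_top x) hx hxU
      rw [Subgroup.card_top, hcard, hUcard]
      norm_num
    have hZ21 : Subgroup.upperCentralSeries P 2 ≤ Subgroup.upperCentralSeries P 1 := by
      rw [Subgroup.upperCentralSeries_one]
      exact Subgroup.centralizer_eq_top_iff_subset.1 (top_le_iff.1 htop)
    have := Subgroup.card_le_of_le hZ21
    rw [hZcard 2 (by norm_num), hZcard 1 (by norm_num)] at this
    norm_num at this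
  · refine absurd (MulAut.eq_one_of_card_quotient_frattini hUp hr hr5 ?_ hφr) hφ1
    let N : Subgroup P := (frattini U).map U.subtype
    have hN : N.Normal := ConjAct.normal_of_characteristic_of_normal
    have hmem : ∀ x : U, x ∈ frattini U → (x : P) ∈ N := fun x hx ↦ ⟨x, hx, rfl⟩
    have hnot : ¬ N ≤ Subgroup.upperCentralSeries P (k + 1) := fun h ↦
      Subgroup.not_elementary_mod_upperCentralSeries hcard hclass hU
        (fun u hu v hv ↦ h (hmem _ (Subgroup.commutator_mem_frattini hUp ⟨u, hu⟩ ⟨v, hv⟩)))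
        (fun u hu ↦ h (hmem _ (Subgroup.pow_mem_frattini hUp ⟨u, hu⟩)))
    have hle := Subgroup.upperCentralSeries_succ_le_of_not_le hp hcard hclass' (by omega) hnot
    have hdvd := Subgroup.card_dvd_of_le hle
    rw [hZcard _ (by omega), Subgroup.card_map_of_injective U.subtype_injective] at hdvd
    have hmul := (frattini U).card_mul_index
    rw [hUcard, show k + 1 + 3 = (k + 1 + 1) + 2 by ring, pow_add 3 (k + 1 + 1)] at hmul
    refine Nat.dvd_of_mul_dvd_mul_left (pow_pos (by norm_num : 0 < 3) (k + 1 + 1)) ?_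
    exact (Nat.mul_dvd_mul_right hdvd _).trans (dvd_of_eq hmul)
end
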